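/- arXiv:1305.6353 — 3 statements merged into one kernel-verified Lean document; each statement's English description precedes it below -/
import Mathlib

section
/- Let Λ = U³ ⊕ E8² ⊕ ⟨−2⟩ and let ι, ι′ ∈ O(Λ) be involutions whose invariant sublattices Λ^ι and Λ^{ι′} are both isometric to ⟨2⟩ ⊕ ⟨−2⟩. Let g ∈ Λ^ι and g′ ∈ Λ^{ι′} be elements of square −2 (each is unique up to sign), and suppose div_Λ(g) = div_Λ(g′) = 1. Then ι and ι′ are conjugate in O(Λ): there exists γ ∈ O(Λ) with ι′ = γ ∘ ι ∘ γ⁻¹. -/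
open Matrix

/-- The Gram pairing `(x, y) ↦ xᵀ G y` of an integer matrix `G`, as a bilinear map. -/
def gramBilin {n : ℕ} (G : Matrix (Fin n) (Fin n) ℤ) :
    (Fin n → ℤ) →ₗ[ℤ] (Fin n → ℤ) →ₗ[ℤ] ℤ :=
  Matrix.toLinearMap₂' ℤ G

/-- The hyperbolic plane `U`, with Gram matrix `[[0,1],[1,0]]`. -/
def UGram : Matrix (Fin 2) (Fin 2) ℤ := !![0, 1; 1, 0]

/-- `U(2)`, with Gram matrix `[[0,2],[2,0]]`. -/
def U2Gram : Matrix (Fin 2) (Fin 2) ℤ := !![0, 2; 2, 0]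

/-- `⟨2⟩ ⊕ ⟨-2⟩`. -/
def diag2Gram : Matrix (Fin 2) (Fin 2) ℤ := !![2, 0; 0, -2]

/-- The (negative definite even unimodular) `E8` lattice: the negative of the E₈ Cartan matrix. -/
def E8Gram : Matrix (Fin 8) (Fin 8) ℤ := -CartanMatrix.E₈

/-- The rank-one lattice `⟨k⟩`. -/
def rankOneGram (k : ℤ) : Matrix (Fin 1) (Fin 1) ℤ := !![k]

/-- Orthogonal direct sum of two bilinear forms, on the product module. -/
def prodBilin {M N : Type*} [AddCommGroup M] [AddCommGroup N] [Module ℤ M] [Module ℤ N]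
    (BM : M →ₗ[ℤ] M →ₗ[ℤ] ℤ) (BN : N →ₗ[ℤ] N →ₗ[ℤ] ℤ) :
    (M × N) →ₗ[ℤ] (M × N) →ₗ[ℤ] ℤ :=
  LinearMap.mk₂ ℤ (fun x y => BM x.1 y.1 + BN x.2 y.2)
    (by intro m₁ m₂ n; simp [map_add]; ring)
    (by intro c m n; simp [_root_.map_smul, smul_eq_mul]; ring)
    (by intro m n₁ n₂; simp [map_add]; ring)
    (by intro c m n; simp [_root_.map_smul, smul_eq_mul]; ring)

/-- The underlying module of `Λ = U³ ⊕ E8² ⊕ ⟨-2⟩`. -/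
abbrev LambdaM : Type :=
  (Fin 2 → ℤ) × (Fin 2 → ℤ) × (Fin 2 → ℤ) × (Fin 8 → ℤ) × (Fin 8 → ℤ) × (Fin 1 → ℤ)

/-- The bilinear form of the Beauville–Bogomolov lattice `Λ = U³ ⊕ E8² ⊕ ⟨-2⟩`. -/
def LambdaB : LambdaM →ₗ[ℤ] LambdaM →ₗ[ℤ] ℤ :=
  prodBilin (gramBilin UGram) <| prodBilin (gramBilin UGram) <| prodBilin (gramBilin UGram) <|
    prodBilin (gramBilin E8Gram) <| prodBilin (gramBilin E8Gram) (gramBilin (rankOneGram (-2)))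

/-- Membership in `O(Λ)`: a linear automorphism preserving the form. -/
def IsIsometry (f : LambdaM ≃ₗ[ℤ] LambdaM) : Prop :=
  ∀ x y, LambdaB (f x) (f y) = LambdaB x y

/-- The invariant sublattice `Λ^ι = {x | ι x = x}`. -/
def invLattice (f : LambdaM ≃ₗ[ℤ] LambdaM) : Submodule ℤ LambdaM :=
  LinearMap.eqLocus (f : LambdaM →ₗ[ℤ] LambdaM) (LinearMap.id)

/-- A submodule of `Λ`, with the restricted form, is isometric to the lattice `(N, BN)`. -/
def IsometricTo {N : Type*} [AddCommGroup N] [Module ℤ N]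
    (K : Submodule ℤ LambdaM) (BN : N →ₗ[ℤ] N →ₗ[ℤ] ℤ) : Prop :=
  ∃ e : K ≃ₗ[ℤ] N, ∀ x y : K, BN (e x) (e y) = LambdaB (x : LambdaM) (y : LambdaM)

/-- `div_Λ(v) = d`: the ideal of values `B(v, ·)` is generated by the positive integer `d`. -/
def HasDivisibility (v : LambdaM) (d : ℤ) : Prop :=
  0 < d ∧ (∀ x, d ∣ LambdaB v x) ∧ ∃ x, LambdaB v x = d

/-- Conjugacy in `O(Λ)`: `ι' = γ ∘ ι ∘ γ⁻¹` for some isometry `γ`. -/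
def ConjInO (ι ι' : LambdaM ≃ₗ[ℤ] LambdaM) : Prop :=
  ∃ γ : LambdaM ≃ₗ[ℤ] LambdaM, IsIsometry γ ∧ ∀ x, ι' x = γ (ι (γ.symm x))

/-- A sublattice has signature (1,1): rank two, containing both an element of positive
square and an element of negative square. -/
def SigOneOne (K : Submodule ℤ LambdaM) : Prop :=
  Module.finrank ℤ K = 2 ∧ (∃ x ∈ K, 0 < LambdaB x x) ∧ (∃ x ∈ K, LambdaB x x < 0)

/-- The orthogonal complement of a submodule of `Λ`. -/
def perpOf (K : Submodule ℤ LambdaM) : Submodule ℤ LambdaM where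
  carrier := {x | ∀ s ∈ K, LambdaB x s = 0}
  add_mem' := by
    intro a b ha hb s hs
    simp [map_add, LinearMap.add_apply, ha s hs, hb s hs]
  zero_mem' := by
    intro s hs
    simp
  smul_mem' := by
    intro c a ha s hs
    simp only [_root_.map_smul, LinearMap.smul_apply, ha s hs, smul_zero]

section Eichler

variable {L : Type*} [AddCommGroup L] {B : L →ₗ[ℤ] L →ₗ[ℤ] ℤ}

/-- The Eichler transvection `x ↦ x + B(e,x) u - B(u,x) e - k B(e,x) e`; it preserves `B` if
`B(e,e) = B(e,u) = 0` and `B(u,u) = 2k`. -/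
def transvectionMap (B : L →ₗ[ℤ] L →ₗ[ℤ] ℤ) (e u : L) (k : ℤ) : L →ₗ[ℤ] L :=
  LinearMap.id + (B e).smulRight u - (B u).smulRight e - k • (B e).smulRight e

lemma transvectionMap_apply (e u : L) (k : ℤ) (x : L) :
    transvectionMap B e u k x = x + B e x • u - B u x • e - (k * B e x) • e := by
  simp only [transvectionMap, LinearMap.add_apply, LinearMap.sub_apply, LinearMap.smul_apply,
    LinearMap.smulRight_apply, LinearMap.id_apply]
  module

lemma transvectionMap_neg (hB : ∀ x y, B x y = B y x) {e u : L} {k : ℤ}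
    (hee : B e e = 0) (heu : B e u = 0) (huu : B u u = 2 * k) (x : L) :
    transvectionMap B e (-u) k (transvectionMap B e u k x) = x := by
  have hue : B u e = 0 := by rw [hB, heu]
  simp only [transvectionMap_apply, map_add, map_sub, map_neg, LinearMap.neg_apply, map_smul,
    hee, heu, hue, huu]
  module

/-- The Eichler transvection as a linear automorphism. -/
def transvectionEquiv (hB : ∀ x y, B x y = B y x) {e u : L} {k : ℤ}
    (hee : B e e = 0) (heu : B e u = 0) (huu : B u u = 2 * k) : L ≃ₗ[ℤ] L :=
  LinearEquiv.ofLinearMap (transvectionMap B e u k) (transvectionMap B e (-u) k)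
    (LinearMap.ext fun x => by
      have := transvectionMap_neg (u := -u) (k := k) hB hee (by simp [heu]) (by simp [huu]) x
      rwa [neg_neg] at this)
    (LinearMap.ext fun x => transvectionMap_neg hB hee heu huu x)

lemma transvectionMap_isometry (hB : ∀ x y, B x y = B y x) {e u : L} {k : ℤ}
    (hee : B e e = 0) (heu : B e u = 0) (huu : B u u = 2 * k) (x y : L) :
    B (transvectionMap B e u k x) (transvectionMap B e u k y) = B x y := by
  have hue : B u e = 0 := by rw [hB, heu]
  simp only [transvectionMap_apply, map_add, map_sub, map_smul, LinearMap.add_apply,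
    LinearMap.sub_apply, LinearMap.smul_apply, hee, heu, hue, huu, smul_eq_mul, hB x e, hB x u]
  ring

/-- `x` is the image of `v` under an isometry of `B` fixing `h`. -/
def InOrbit (B : L →ₗ[ℤ] L →ₗ[ℤ] ℤ) (h v x : L) : Prop :=
  ∃ γ : L ≃ₗ[ℤ] L, (∀ a b, B (γ a) (γ b) = B a b) ∧ γ h = h ∧ γ v = x

lemma InOrbit.refl (h v : L) : InOrbit B h v v :=
  ⟨LinearEquiv.refl ℤ L, fun _ _ => rfl, rfl, rfl⟩

lemma InOrbit.trans {h v x y : L} (hx : InOrbit B h v x) (hy : InOrbit B h x y) :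
    InOrbit B h v y := by
  obtain ⟨γ, hγ, hh, rfl⟩ := hx
  obtain ⟨γ', hγ', hh', rfl⟩ := hy
  exact ⟨γ.trans γ', fun a b => by simp [hγ, hγ'], by simp [hh, hh'], rfl⟩

lemma InOrbit.orthogonal {h v x : L} (hx : InOrbit B h v x) (hv : B v h = 0) : B x h = 0 := by
  obtain ⟨γ, hγ, hh, rfl⟩ := hx
  have := hγ v h
  rwa [hh, hv] at this

lemma InOrbit.transvection (hB : ∀ x y, B x y = B y x) (hev : ∀ x, Even (B x x))
    {h v x e u : L} (hx : InOrbit B h v x) (hee : B e e = 0) (heu : B e u = 0)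
    (heh : B e h = 0) (huh : B u h = 0) :
    ∃ k, InOrbit B h v (x + B e x • u - B u x • e - (k * B e x) • e) := by
  obtain ⟨k, hk⟩ := even_iff_exists_two_mul.mp (hev u)
  refine ⟨k, hx.trans ⟨transvectionEquiv hB hee heu hk, transvectionMap_isometry hB hee heu hk,
    ?_, transvectionMap_apply e u k x⟩⟩
  change transvectionMap B e u k h = h
  simp [transvectionMap_apply, heh, huh]

lemma InOrbit.transvection_isotropic (hB : ∀ x y, B x y = B y x)
    {h v x e u : L} (hx : InOrbit B h v x) (hee : B e e = 0) (heu : B e u = 0) (huu : B u u = 0)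
    (heh : B e h = 0) (huh : B u h = 0) (n : ℤ) :
    InOrbit B h v (x + (n * B e x) • u - (n * B u x) • e) := by
  have hk : B (n • u) (n • u) = 2 * 0 := by simp [huu]
  have heu' : B e (n • u) = 0 := by simp [heu]
  refine hx.trans ⟨transvectionEquiv hB hee heu' hk, transvectionMap_isometry hB hee heu' hk,
    ?_, ?_⟩
  · change transvectionMap B e (n • u) 0 h = h
    simp [transvectionMap_apply, heh, huh]
  · change transvectionMap B e (n • u) 0 x = _
    rw [transvectionMap_apply]
    simp only [map_smul, LinearMap.smul_apply, smul_eq_mul]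
    module

/-- `e, f` and `e', f'` span two orthogonal hyperbolic planes in the orthogonal complement
of `h`. -/
structure HyperbolicPairs (B : L →ₗ[ℤ] L →ₗ[ℤ] ℤ) (h e f e' f' : L) : Prop where
  ee : B e e = 0
  ff : B f f = 0
  ef : B e f = 1
  ee₂ : B e' e' = 0
  ff₂ : B f' f' = 0
  ef₂ : B e' f' = 1
  cross_ee : B e e' = 0
  cross_ef : B e f' = 0
  cross_fe : B f e' = 0
  cross_ff : B f f' = 0
  eh : B e h = 0
  fh : B f h = 0
  eh₂ : B e' h = 0
  fh₂ : B f' h = 0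

namespace HyperbolicPairs

variable {h e f e' f' v : L}

lemma swap (hB : ∀ x y, B x y = B y x) (H : HyperbolicPairs B h e f e' f') :
    HyperbolicPairs B h e f f' e' :=
  ⟨H.ee, H.ff, H.ef, H.ff₂, H.ee₂, (hB _ _).trans H.ef₂, H.cross_ef, H.cross_ee, H.cross_ff,
    H.cross_fe, H.eh, H.fh, H.fh₂, H.eh₂⟩

/-- Adding a multiple of the coefficient of `e` to that of `f'`. -/
lemma exists_add_left (hB : ∀ x y, B x y = B y x) (H : HyperbolicPairs B h e f e' f') {x : L}
    (hx : InOrbit B h v x) (n : ℤ) :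
    ∃ y, InOrbit B h v y ∧ B f y = B f x ∧ B e' y = B e' x + n * B f x ∧ B f' y = B f' x ∧
      B e y = B e x - n * B f' x :=
  ⟨_, hx.transvection_isotropic hB H.ff H.cross_ff H.ff₂ H.fh H.fh₂ n, by
    have h1 := hB e' f ▸ H.cross_fe
    have h2 := hB f' f ▸ H.cross_ff
    simp [H.ff, H.cross_ff, H.ef₂, H.ff₂, H.cross_ef, H.ef, h1, h2]⟩

/-- Adding a multiple of the coefficient of `f'` to that of `e`. -/
lemma exists_add_right (hB : ∀ x y, B x y = B y x) (H : HyperbolicPairs B h e f e' f') {x : L}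
    (hx : InOrbit B h v x) (n : ℤ) :
    ∃ y, InOrbit B h v y ∧ B f y = B f x + n * B e' x ∧ B e' y = B e' x ∧
      B f' y = B f' x - n * B e x :=
  ⟨_, hx.transvection_isotropic hB H.ee₂ ((hB _ _).trans H.cross_ee) H.ee H.eh₂ H.eh n, by
    have h1 := hB e' e ▸ H.cross_ee
    have h2 := hB f' e ▸ H.cross_ef
    have h3 := hB f' e' ▸ H.ef₂
    have h4 := hB f e ▸ H.ef
    simp [h1, h2, h3, h4, H.cross_fe, H.ee₂]⟩

/-- A minimal positive coefficient of `e` in an orbit divides the coefficient of `f'`. -/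
lemma dvd_of_minimal (hB : ∀ x y, B x y = B y x) (H : HyperbolicPairs B h e f e' f') {p : ℤ}
    (hp : 0 < p) (hmin : ∀ y, InOrbit B h v y → 0 < B f y → p ≤ B f y) {x : L}
    (hx : InOrbit B h v x) (hxp : B f x = p) : p ∣ B e' x := by
  obtain ⟨y, hy, hy1, hy2, -⟩ := H.exists_add_left hB hx (-(B e' x / p))
  have hr : B e' y = B e' x % p := by
    rw [hy2, hxp, Int.emod_def]; ring
  by_contra hnd
  have hr0 : 0 < B e' x % p :=
    lt_of_le_of_ne (Int.emod_nonneg _ hp.ne') fun h0 => hnd (Int.dvd_of_emod_eq_zero h0.symm)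
  have hrp := Int.emod_lt_of_pos (B e' x) hp
  set r := B e' x % p
  obtain ⟨z, hz, hz1, -⟩ := H.exists_add_right hB hy (-((p - 1) / r))
  have h1 := Int.emod_nonneg (p - 1) hr0.ne'
  have h2 := Int.emod_lt_of_pos (p - 1) hr0
  have h3 : B f z = (p - 1) % r + 1 := by
    rw [hz1, hy1, hxp, hr, Int.emod_def]; ring
  have := hmin z hz (by omega)
  omega

/-- If no element of an orbit has a positive coefficient of `e`, then the coefficient of `f'`
vanishes on the orbit. -/
lemma eq_zero_of_nonpos (hB : ∀ x y, B x y = B y x) (H : HyperbolicPairs B h e f e' f')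
    (hneg : ∀ y, InOrbit B h v y → B f y ≤ 0) {x : L} (hx : InOrbit B h v x) : B e' x = 0 := by
  by_contra h0
  obtain ⟨y, hy, hy1, -⟩ := H.exists_add_right hB hx ((1 - B f x) * B e' x)
  have h1 := hneg y hy
  have h2 := hneg x hx
  have h3 : 0 < B e' x * B e' x := mul_self_pos.mpr h0
  rw [hy1] at h1
  nlinarith

lemma exists_sub_projection (hB : ∀ x y, B x y = B y x) (H : HyperbolicPairs B h e f e' f') (w : L)
    (hw : B w h = 0) : ∃ u, B u h = 0 ∧ B e u = 0 ∧ B f u = 0 ∧ B e' u = 0 ∧ B f' u = 0 ∧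
      ∀ x, B w x = B u x + B f w * B e x + B e w * B f x + B f' w * B e' x + B e' w * B f' x := by
  have h1 := hB e' e ▸ H.cross_ee
  have h2 := hB f' e ▸ H.cross_ef
  have h3 := hB f' e' ▸ H.ef₂
  have h4 := hB f e ▸ H.ef
  have h5 := hB e' f ▸ H.cross_fe
  have h6 := hB f' f ▸ H.cross_ff
  refine ⟨w - B f w • e - B e w • f - B f' w • e' - B e' w • f', ?_, ?_, ?_, ?_, ?_, ?_⟩
  · simp [hw, H.eh, H.fh, H.eh₂, H.fh₂]
  · simp [H.ee, H.ef, H.cross_ee, H.cross_ef]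
  · simp [H.ff, h4, H.cross_fe, H.cross_ff]
  · simp [h1, h5, H.ee₂, H.ef₂]
  · simp [h2, h6, h3, H.ff₂]
  · intro x
    simp only [map_sub, map_smul, LinearMap.sub_apply, LinearMap.smul_apply, smul_eq_mul]
    ring

lemma exists_pos (hB : ∀ x y, B x y = B y x) (hev : ∀ x, Even (B x x))
    (H : HyperbolicPairs B h e f e' f') {w : L} (hw : B w h = 0) (hwv : B w v = 1) :
    ∃ x, InOrbit B h v x ∧ 0 < B f x := by
  by_contra! hneg
  have hv := InOrbit.refl (B := B) h v
  have hd {x : L} (hx : InOrbit B h v x) : B e' x = 0 := H.eq_zero_of_nonpos hB hneg hx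
  have hc {x : L} (hx : InOrbit B h v x) : B f' x = 0 := (H.swap hB).eq_zero_of_nonpos hB hneg hx
  have ha : B f v = 0 := by
    obtain ⟨y, hy, -, hy2, -⟩ := H.exists_add_left hB hv 1
    linarith [hd hy, hd hv]
  have hb : B e v = 0 := by
    obtain ⟨y, hy, -, -, hy2⟩ := H.exists_add_right hB hv 1
    linarith [hc hy, hc hv]
  obtain ⟨u, huh, hue, huf, hue', huf', hu⟩ := H.exists_sub_projection hB w hw
  obtain ⟨k, hk⟩ := hv.transvection hB hev H.ff₂ huf' H.fh₂ huh
  have := hd hk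
  simp only [map_add, map_sub, map_smul, hc hv, hd hv, hue', H.ef₂, smul_eq_mul] at this
  have := hu v
  rw [ha, hb, hc hv, hd hv] at this
  linarith

/-- Eichler's criterion in divisibility one, relative to a fixed vector `h`. -/
theorem eichler (hB : ∀ x y, B x y = B y x) (hev : ∀ x, Even (B x x))
    (H : HyperbolicPairs B h e f e' f') {w : L} (hvh : B v h = 0) (hw : B w h = 0)
    (hwv : B w v = 1) {k : ℤ} (hk : B v v = 2 * k) : InOrbit B h v (e + k • f) := by
  obtain ⟨x₀, hx₀, hpos⟩ := H.exists_pos hB hev hw hwv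
  obtain ⟨p, ⟨hp, x, hx, hxp⟩, hmin'⟩ := Int.exists_least_of_bdd
    (P := fun p => 0 < p ∧ ∃ x, InOrbit B h v x ∧ B f x = p) ⟨0, fun z hz => hz.1.le⟩
    ⟨_, hpos, x₀, hx₀, rfl⟩
  have hmin : ∀ y, InOrbit B h v y → 0 < B f y → p ≤ B f y :=
    fun y hy h0 => hmin' _ ⟨h0, y, hy, rfl⟩
  have hd {x : L} (hx : InOrbit B h v x) (hxp : B f x = p) : p ∣ B e' x :=
    H.dvd_of_minimal hB hp hmin hx hxp
  have hc {x : L} (hx : InOrbit B h v x) (hxp : B f x = p) : p ∣ B f' x :=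
    (H.swap hB).dvd_of_minimal hB hp hmin hx hxp
  have hb : p ∣ B e x := by
    obtain ⟨c, hc'⟩ := hd hx hxp
    obtain ⟨y, hy, hy1, hy2, hy3, hy4⟩ := H.exists_add_left hB hx (-c)
    have hy2' : B e' y = 0 := by rw [hy2, hc', hxp]; ring
    obtain ⟨z, hz, hz1, -, hz3⟩ := H.exists_add_right hB hy 1
    have hzp : B f z = p := by rw [hz1, hy2', hy1, hxp]; ring
    have h1 := dvd_sub (hc hy (hy1.trans hxp)) (hc hz hzp)
    have h2 : B e x = B f' y - B f' z - c * B f' x := by rw [hz3, hy4]; ring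
    rw [h2]
    exact dvd_sub h1 ((hc hx hxp).mul_left c)
  have hdvd : ∀ w, B w h = 0 → p ∣ B w x := by
    intro w hw
    obtain ⟨u, huh, hue, huf, hue', huf', hu⟩ := H.exists_sub_projection hB w hw
    obtain ⟨k, hk⟩ := hx.transvection hB hev H.ff₂ huf' H.fh₂ huh
    have hux : p ∣ B u x := by
      have h1 := hd hk (by simp [huf, H.cross_ff, hxp])
      simp only [map_add, map_sub, map_smul, hue', H.ef₂, smul_eq_mul] at h1
      have h2 : B u x = B e' x - k * B f' x -
        (B e' x + B f' x * 0 - B u x * 1 - k * B f' x * 1) := by ring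
      rw [h2]
      exact dvd_sub (dvd_sub (hd hx hxp) ((hc hx hxp).mul_left k)) h1
    rw [hu x, hxp]
    exact ((((hux.add (hb.mul_left _)).add (dvd_mul_left _ _)).add
      ((hd hx hxp).mul_left _)).add ((hc hx hxp).mul_left _))
  have hxh := hx.orthogonal hvh
  have hp1 : p = 1 := by
    obtain ⟨γ, hγ, hγh, rfl⟩ := hx
    have h1 := hdvd (γ w) (by have := hγ w h; rwa [hγh, hw] at this)
    rw [hγ, hwv] at h1
    exact Int.eq_one_of_dvd_one hp.le h1
  subst hp1
  have hfe := hB f e ▸ H.ef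
  have hfu : B f (-(x - e - B e x • f)) = 0 := by simp [hxp, hfe, H.ff]
  have huh : B (-(x - e - B e x • f)) h = 0 := by simp [hxh, H.eh, H.fh]
  obtain ⟨j, hj⟩ := hx.transvection hB hev H.ff hfu H.fh huh
  obtain ⟨l, hl⟩ : ∃ l : ℤ, InOrbit B h v (e + l • f) := by
    refine ⟨B e x - B (-(x - e - B e x • f)) x - j, ?_⟩
    convert hj using 1
    rw [hxp]
    module
  have hlk : l = k := by
    obtain ⟨γ, hγ, -, hγv⟩ := hl
    have := hγ v v
    rw [hγv, hk] at this
    simp [H.ee, H.ef, H.ff, hfe] at this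
    linarith
  rwa [← hlk]

end HyperbolicPairs

end Eichler

section LambdaLattice

lemma gramBilin_comm {n : ℕ} {G : Matrix (Fin n) (Fin n) ℤ} (hG : Gᵀ = G) (x y : Fin n → ℤ) :
    gramBilin G x y = gramBilin G y x := by
  rw [gramBilin, Matrix.toLinearMap₂'_apply', Matrix.toLinearMap₂'_apply', dotProduct_mulVec,
    ← mulVec_transpose, hG, dotProduct_comm]

/-- A vector is recovered from its pairings with the columns of the inverse Gram matrix. -/
lemma gramBilin_col {n : ℕ} {G D : Matrix (Fin n) (Fin n) ℤ} (hGD : G * D = 1) (x : Fin n → ℤ)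
    (i : Fin n) : gramBilin G x (D.col i) = x i := by
  have h : G *ᵥ D.col i = Pi.single i 1 := by
    rw [← mulVec_single_one, mulVec_mulVec, hGD, one_mulVec]
  rw [gramBilin, Matrix.toLinearMap₂'_apply', h, dotProduct_single_one]

lemma UGram_mul_self : UGram * UGram = 1 := by decide

/-- The inverse of `E8Gram`. -/
def E8GramInv : Matrix (Fin 8) (Fin 8) ℤ := !![-4, -5, -7, -10, -8, -6, -4, -2;
  -5, -8, -10, -15, -12, -9, -6, -3;
  -7, -10, -14, -20, -16, -12, -8, -4;
  -10, -15, -20, -30, -24, -18, -12, -6;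
  -8, -12, -16, -24, -20, -15, -10, -5;
  -6, -9, -12, -18, -15, -12, -8, -4;
  -4, -6, -8, -12, -10, -8, -6, -3;
  -2, -3, -4, -6, -5, -4, -3, -2]

lemma E8Gram_mul_inv : E8Gram * E8GramInv = 1 := by decide

lemma gramBilin_UGram (x y : Fin 2 → ℤ) : gramBilin UGram x y = x 0 * y 1 + x 1 * y 0 := by
  simp [gramBilin, Matrix.toLinearMap₂'_apply', UGram, dotProduct, mulVec, Fin.sum_univ_two]

lemma gramBilin_rankOneGram (k : ℤ) (x y : Fin 1 → ℤ) :
    gramBilin (rankOneGram k) x y = k * (x 0 * y 0) := by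
  simp [gramBilin, Matrix.toLinearMap₂'_apply', rankOneGram, dotProduct, mulVec]
  ring

lemma gramBilin_diag2Gram (x y : Fin 2 → ℤ) :
    gramBilin diag2Gram x y = 2 * (x 0 * y 0) - 2 * (x 1 * y 1) := by
  simp [gramBilin, Matrix.toLinearMap₂'_apply', diag2Gram, dotProduct, mulVec, Fin.sum_univ_two]
  ring

lemma even_gramBilin_E8Gram (x : Fin 8 → ℤ) : Even (gramBilin E8Gram x x) := by
  rw [even_iff_exists_two_mul]
  refine ⟨-(x 0 ^ 2 + x 1 ^ 2 + x 2 ^ 2 + x 3 ^ 2 + x 4 ^ 2 + x 5 ^ 2 + x 6 ^ 2 + x 7 ^ 2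
    - x 0 * x 2 - x 1 * x 3 - x 2 * x 3 - x 3 * x 4 - x 4 * x 5 - x 5 * x 6 - x 6 * x 7), ?_⟩
  simp [gramBilin, Matrix.toLinearMap₂'_apply', E8Gram, CartanMatrix.E₈, dotProduct, mulVec,
    Fin.sum_univ_eight]
  ring

lemma LambdaB_apply (x y : LambdaM) : LambdaB x y = gramBilin UGram x.1 y.1 +
    (gramBilin UGram x.2.1 y.2.1 + (gramBilin UGram x.2.2.1 y.2.2.1 +
    (gramBilin E8Gram x.2.2.2.1 y.2.2.2.1 + (gramBilin E8Gram x.2.2.2.2.1 y.2.2.2.2.1 +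
    gramBilin (rankOneGram (-2)) x.2.2.2.2.2 y.2.2.2.2.2)))) := rfl

lemma LambdaB_comm (x y : LambdaM) : LambdaB x y = LambdaB y x := by
  have hU : UGramᵀ = UGram := by decide
  have hE : E8Gramᵀ = E8Gram := by decide
  rw [LambdaB_apply, LambdaB_apply, gramBilin_comm hU x.1, gramBilin_comm hU x.2.1,
    gramBilin_comm hU x.2.2.1, gramBilin_comm hE x.2.2.2.1, gramBilin_comm hE x.2.2.2.2.1,
    gramBilin_rankOneGram, gramBilin_rankOneGram, mul_comm (x.2.2.2.2.2 0)]

lemma even_LambdaB (x : LambdaM) : Even (LambdaB x x) := by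
  have hU (y : Fin 2 → ℤ) : Even (gramBilin UGram y y) :=
    ⟨y 0 * y 1, by rw [gramBilin_UGram]; ring⟩
  rw [LambdaB_apply]
  exact (hU _).add ((hU _).add ((hU _).add ((even_gramBilin_E8Gram _).add
    ((even_gramBilin_E8Gram _).add ⟨-(x.2.2.2.2.2 0 * x.2.2.2.2.2 0), by
      rw [gramBilin_rankOneGram]; ring⟩))))

lemma exists_eq_two_smul {n : ℕ} {x : Fin n → ℤ} (h : ∀ i, Even (x i)) :
    ∃ y : Fin n → ℤ, x = (2 : ℤ) • y := by
  choose y hy using fun i => even_iff_exists_two_mul.mp (h i)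
  exact ⟨y, funext fun i => by simp [hy]⟩

/-- A vector pairing evenly with all of `Λ` is, up to `2Λ`, a multiple of the generator
of `⟨-2⟩`. -/
lemma exists_of_even_LambdaB {v : LambdaM} (h : ∀ x, Even (LambdaB v x)) :
    ∃ (w : LambdaM) (n : ℤ), v = (2 : ℤ) • w + n • ((0, 0, 0, 0, 0, 1) : LambdaM) ∧
      LambdaB v v = 4 * LambdaB w w - 2 * n ^ 2 := by
  obtain ⟨v₁, v₂, v₃, v₄, v₅, v₆⟩ := v
  obtain ⟨w₁, rfl⟩ := exists_eq_two_smul (x := v₁) fun i => by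
    simpa [LambdaB_apply, gramBilin_col UGram_mul_self] using h (UGram.col i, 0, 0, 0, 0, 0)
  obtain ⟨w₂, rfl⟩ := exists_eq_two_smul (x := v₂) fun i => by
    simpa [LambdaB_apply, gramBilin_col UGram_mul_self] using h (0, UGram.col i, 0, 0, 0, 0)
  obtain ⟨w₃, rfl⟩ := exists_eq_two_smul (x := v₃) fun i => by
    simpa [LambdaB_apply, gramBilin_col UGram_mul_self] using h (0, 0, UGram.col i, 0, 0, 0)
  obtain ⟨w₄, rfl⟩ := exists_eq_two_smul (x := v₄) fun i => by
    simpa [LambdaB_apply, gramBilin_col E8Gram_mul_inv] using h (0, 0, 0, E8GramInv.col i, 0, 0)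
  obtain ⟨w₅, rfl⟩ := exists_eq_two_smul (x := v₅) fun i => by
    simpa [LambdaB_apply, gramBilin_col E8Gram_mul_inv] using h (0, 0, 0, 0, E8GramInv.col i, 0)
  refine ⟨(w₁, w₂, w₃, w₄, w₅, 0), v₆ 0, ?_, ?_⟩
  · have : v₆ = v₆ 0 • (1 : Fin 1 → ℤ) := funext fun i => by simp [Subsingleton.elim i 0]
    simpa using this
  · simp only [LambdaB_apply, map_smul, LinearMap.smul_apply, gramBilin_rankOneGram, smul_eq_mul,
      Pi.zero_apply]
    ring

lemma exists_odd_of_sq_two {h : LambdaM} (hh : LambdaB h h = 2) : ∃ x, Odd (LambdaB h x) := by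
  by_contra! hne
  obtain ⟨w, n, -, hn⟩ := exists_of_even_LambdaB fun x => Int.not_odd_iff_even.mp (hne x)
  obtain ⟨k, hk⟩ := even_LambdaB w
  rw [hh] at hn
  rcases Int.even_or_odd' n with ⟨m, rfl | rfl⟩ <;> ring_nf at hn <;> omega

lemma exists_odd_of_sq_zero {u : LambdaM} (hu : LambdaB u u = 0)
    (hprim : ∀ w : LambdaM, u ≠ (2 : ℤ) • w) : ∃ x, Odd (LambdaB u x) := by
  by_contra! hne
  obtain ⟨w, n, hw, hn⟩ := exists_of_even_LambdaB fun x => Int.not_odd_iff_even.mp (hne x)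
  rw [hu] at hn
  rcases Int.even_or_odd' n with ⟨m, rfl | rfl⟩
  · exact hprim (w + m • ((0, 0, 0, 0, 0, 1) : LambdaM)) (by rw [hw]; module)
  · ring_nf at hn
    omega

/-- Orthogonal vectors `h`, `g` of squares `2`, `-2` spanning a primitive sublattice, with `g` of
divisibility one, are moved to standard position by an isometry. -/
lemma exists_isometry_standard {h g : LambdaM} (hh : LambdaB h h = 2) (hg : LambdaB g g = -2)
    (hhg : LambdaB h g = 0) (hprim : ∀ w : LambdaM, h + g ≠ (2 : ℤ) • w)
    (hdiv : HasDivisibility g 1) :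
    ∃ γ : LambdaM ≃ₗ[ℤ] LambdaM, IsIsometry γ ∧
      γ h = (![1, 1], 0, 0, 0, 0, 0) ∧ γ g = (0, ![1, -1], 0, 0, 0, 0) := by
  have hgh : LambdaB g h = 0 := by rw [LambdaB_comm, hhg]
  obtain ⟨x, hx⟩ := exists_odd_of_sq_two hh
  obtain ⟨x', hx'⟩ := exists_odd_of_sq_zero (u := h + g) (by simp [hh, hg, hhg, hgh]) hprim
  obtain ⟨z, hz⟩ := hdiv.2.2
  obtain ⟨y, hyh, hyg⟩ : ∃ y, Even (LambdaB h y) ∧ Odd (LambdaB g y) := by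
    by_contra! hne
    have h1 := hne z
    have h2 := hne x'
    have h3 := hne (z + x)
    have h4 := hne (z + x')
    simp only [map_add, LinearMap.add_apply, hz] at h1 h2 h3 h4 hx'
    grind
  obtain ⟨w, hw⟩ : ∃ w, LambdaB w h = 1 := by
    obtain ⟨l, hl⟩ := hx
    exact ⟨x - l • h, by
      rw [LambdaB_comm, map_sub, map_smul, smul_eq_mul, hl, hh]; ring⟩
  obtain ⟨t, hth, htg⟩ : ∃ t, LambdaB t h = 0 ∧ LambdaB t g = 1 := by
    obtain ⟨k, hk⟩ := even_iff_exists_two_mul.mp hyh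
    obtain ⟨l, hl⟩ := hyg
    refine ⟨y - k • h + l • g, ?_, ?_⟩
    · rw [LambdaB_comm]; simp only [map_add, map_sub, map_smul, smul_eq_mul, hk, hh, hhg]; ring
    · rw [LambdaB_comm]; simp only [map_add, map_sub, map_smul, smul_eq_mul, hl, hg, hgh]; ring
  have H₁ : HyperbolicPairs LambdaB 0 (![1, 0], 0, 0, 0, 0, 0) (![0, 1], 0, 0, 0, 0, 0)
      (0, ![1, 0], 0, 0, 0, 0) (0, ![0, 1], 0, 0, 0, 0) := by
    constructor <;> simp [LambdaB_apply, gramBilin_UGram]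
  have H₂ : HyperbolicPairs LambdaB (![1, 1], 0, 0, 0, 0, 0) (0, ![1, 0], 0, 0, 0, 0)
      (0, ![0, 1], 0, 0, 0, 0) (0, 0, ![1, 0], 0, 0, 0) (0, 0, ![0, 1], 0, 0, 0) := by
    constructor <;> simp [LambdaB_apply, gramBilin_UGram]
  obtain ⟨γ, hγ, -, hγh⟩ := H₁.eichler LambdaB_comm even_LambdaB (by simp) (by simp) hw
    (k := 1) (by simp [hh])
  replace hγh : γ h = (![1, 1], 0, 0, 0, 0, 0) := by rw [hγh]; simp
  obtain ⟨γ', hγ', hγ'h, hγ'g⟩ := H₂.eichler LambdaB_comm even_LambdaB (v := γ g) (w := γ t)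
    (by rw [← hγh, hγ, hgh]) (by rw [← hγh, hγ, hth]) (by rw [hγ, htg]) (k := -1)
    (by rw [hγ, hg]; norm_num)
  exact ⟨γ.trans γ', fun a b => by simp [hγ, hγ'], by simp [hγh, hγ'h], by simp [hγ'g]⟩

/-- The shape of an involution with invariant lattice `⟨2⟩ ⊕ ⟨-2⟩`. -/
lemma exists_involution_formula {ι : LambdaM ≃ₗ[ℤ] LambdaM} (hisom : IsIsometry ι)
    (hinvol : ∀ x, ι (ι x) = x) (hK : IsometricTo (invLattice ι) (gramBilin diag2Gram))
    {g : LambdaM} (hg : g ∈ invLattice ι) (hgsq : LambdaB g g = -2) :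
    ∃ h : LambdaM, LambdaB h h = 2 ∧ LambdaB h g = 0 ∧ (∀ w : LambdaM, h + g ≠ (2 : ℤ) • w) ∧
      ∀ x, ι x = LambdaB h x • h - LambdaB g x • g - x := by
  obtain ⟨e, he⟩ := hK
  have mem_iff (x : LambdaM) : x ∈ invLattice ι ↔ ι x = x := Iff.rfl
  set g₀ : invLattice ι := ⟨g, hg⟩
  set h₀ := e.symm ![1, 0]
  have heh : e h₀ = ![1, 0] := e.apply_symm_apply _
  obtain ⟨heg0, heg1⟩ : e g₀ 0 = 0 ∧ (e g₀ 1 = 1 ∨ e g₀ 1 = -1) := by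
    have h1 := he g₀ g₀
    rw [hgsq, gramBilin_diag2Gram] at h1
    have h2 : (e g₀ 1 - e g₀ 0) * (e g₀ 1 + e g₀ 0) = 1 := by linarith
    rcases Int.eq_one_or_neg_one_of_mul_eq_one' h2 with h3 | h3 <;> omega
  have heg1' : e g₀ 1 * e g₀ 1 = 1 := by rcases heg1 with h | h <;> simp [h]
  have hh : LambdaB h₀ h₀ = 2 := by rw [← he, gramBilin_diag2Gram, heh]; simp
  have hhg : LambdaB h₀ g = 0 := by
    rw [show g = g₀ from rfl, ← he, gramBilin_diag2Gram, heh, heg0]; simp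
  have hgh : LambdaB g h₀ = 0 := by rw [LambdaB_comm, hhg]
  have span (y : invLattice ι) : ∃ a b : ℤ, y = a • h₀ + b • g₀ := by
    refine ⟨e y 0, e y 1 * e g₀ 1, e.injective (funext fun i => ?_)⟩
    fin_cases i
    · simp [heh, heg0]
    · simp [heh, mul_assoc, heg1']
  refine ⟨h₀, hh, hhg, fun w hw => ?_, fun x => ?_⟩
  · have hwK : w ∈ invLattice ι := by
      rw [mem_iff]
      have h1 : (2 : ℤ) • ι w = (2 : ℤ) • w := by
        rw [← map_smul, ← hw, map_add, (mem_iff _).mp h₀.2, (mem_iff _).mp hg]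
      exact smul_right_injective LambdaM (two_ne_zero (α := ℤ)) h1
    have h1 : h₀ + g₀ = (2 : ℤ) • (⟨w, hwK⟩ : invLattice ι) := Subtype.ext hw
    have h2 := congrFun (congrArg e h1) 0
    simp only [map_add, map_smul, Pi.add_apply, Pi.smul_apply, heh, heg0, smul_eq_mul,
      Matrix.cons_val_zero] at h2
    omega
  · have hxK : x + ι x ∈ invLattice ι := by
      rw [mem_iff, map_add, hinvol, add_comm]
    obtain ⟨a, b, hab⟩ := span ⟨x + ι x, hxK⟩
    replace hab : x + ι x = a • (h₀ : LambdaM) + b • g := congrArg Subtype.val hab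
    have hι {k : LambdaM} (hk : ι k = k) : LambdaB k (ι x) = LambdaB k x := by
      rw [← hisom k x, hk]
    have h1 := congrArg (LambdaB (h₀ : LambdaM)) hab
    have h2 := congrArg (LambdaB g) hab
    simp only [map_add, map_smul, smul_eq_mul, hι ((mem_iff _).mp h₀.2), hι ((mem_iff _).mp hg),
      hh, hhg, hgh, hgsq] at h1 h2
    rw [show LambdaB h₀ x = a by omega, show LambdaB g x = -b by omega, eq_sub_iff_add_eq,
      add_comm, hab]
    module

end LambdaLattice

/-- Two involutions of `Λ = U³ ⊕ E8² ⊕ ⟨−2⟩` whose invariant sublattices are both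
isometric to `⟨2⟩ ⊕ ⟨−2⟩` and whose square `−2` invariant elements both have
divisibility `1` in `Λ` are conjugate in `O(Λ)`. -/
theorem conjugacy_case_div_one
    (ι ι' : LambdaM ≃ₗ[ℤ] LambdaM)
    (hisom : IsIsometry ι) (hinvol : ∀ x, ι (ι x) = x)
    (hisom' : IsIsometry ι') (hinvol' : ∀ x, ι' (ι' x) = x)
    (hK : IsometricTo (invLattice ι) (gramBilin diag2Gram))
    (hK' : IsometricTo (invLattice ι') (gramBilin diag2Gram))
    (g g' : LambdaM)
    (hg : g ∈ invLattice ι) (hgsq : LambdaB g g = -2)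
    (hg' : g' ∈ invLattice ι') (hgsq' : LambdaB g' g' = -2)
    (hdiv : HasDivisibility g 1) (hdiv' : HasDivisibility g' 1) :
    ConjInO ι ι' := by
  obtain ⟨h, hh, hhg, hprim, hform⟩ := exists_involution_formula hisom hinvol hK hg hgsq
  obtain ⟨h', hh', hhg', hprim', hform'⟩ :=
    exists_involution_formula hisom' hinvol' hK' hg' hgsq'
  obtain ⟨γ, hγ, hγh, hγg⟩ := exists_isometry_standard hh hgsq hhg hprim hdiv
  obtain ⟨γ', hγ', hγh', hγg'⟩ := exists_isometry_standard hh' hgsq' hhg' hprim' hdiv'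
  have hsymm (a b : LambdaM) : LambdaB (γ'.symm a) (γ'.symm b) = LambdaB a b := by
    rw [← hγ', γ'.apply_symm_apply, γ'.apply_symm_apply]
  refine ⟨γ.trans γ'.symm, fun a b => ?_, fun x => ?_⟩
  · simp only [LinearEquiv.trans_apply, hsymm, hγ a b]
  · have eh : γ'.symm (γ h) = h' := by rw [hγh, ← hγh', γ'.symm_apply_apply]
    have eg : γ'.symm (γ g) = g' := by rw [hγg, ← hγg', γ'.symm_apply_apply]
    obtain ⟨y, rfl⟩ := (γ.trans γ'.symm).surjective x
    rw [LinearEquiv.symm_apply_apply, hform, hform']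
    simp only [LinearEquiv.trans_apply, map_sub, map_smul, eh, eg]
    rw [← eh, ← eg, hsymm, hsymm, hγ, hγ]
end

section
/- Let L be a ℤ-module equipped with an integer-valued symmetric bilinear form B, and let g, h ∈ L satisfy B(g,g) = −2 and B(g,h) = 0. Suppose there exists l ∈ L with B(h,l) odd, and there exists m ∈ L with B(g+h,m) odd. Then there exists y ∈ L with B(g,y) = 0 and B(h,y) odd; in other words, h has divisibility 1 in the orthogonal complement {x ∈ L : B(g,x) = 0} of g. -/
/-- Let `L` be a ℤ-module with a symmetric integer-valued bilinear form `B`, and let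
`g, h ∈ L` with `B(g,g) = −2` and `B(g,h) = 0`.  If some `l ∈ L` has `B(h,l)` odd and some
`m ∈ L` has `B(g+h,m)` odd, then there is `y ∈ L` with `B(g,y) = 0` and `B(h,y)` odd;
i.e. `h` has divisibility `1` in the orthogonal complement of `g`. -/
theorem divisibility_one_in_orthogonal_complement
    {L : Type*} [AddCommGroup L] [Module ℤ L]
    (B : L →ₗ[ℤ] L →ₗ[ℤ] ℤ)
    (hsymm : ∀ x y, B x y = B y x)
    (g h : L)
    (hgg : B g g = -2)
    (hgh : B g h = 0)
    (hl : ∃ l : L, Odd (B h l))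
    (hm : ∃ m : L, Odd (B (g + h) m)) :
    ∃ y : L, B g y = 0 ∧ Odd (B h y) := by
  obtain ⟨z, ⟨k, hk⟩, hz⟩ : ∃ z : L, Even (B g z) ∧ Odd (B h z) := by
    obtain ⟨l, hl⟩ := hl
    obtain ⟨m, hm⟩ := hm
    rw [map_add, LinearMap.add_apply] at hm
    by_cases hgl : Even (B g l)
    · exact ⟨l, hgl, hl⟩
    by_cases hgm : Even (B g m)
    · exact ⟨m, hgm, by grind⟩
    · exact ⟨l + m, by rw [map_add]; grind, by rw [map_add]; grind⟩
  refine ⟨z + k • g, ?_, ?_⟩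
  · rw [map_add, map_zsmul, hgg, hk, smul_eq_mul]
    ring
  · rwa [map_add, map_zsmul, hsymm h g, hgh, smul_zero, add_zero]
end

section
/- Let L = U ⊕ ⟨2⟩ and let v, g ∈ L satisfy B(v,v) = 2, B(g,g) = −2, B(v,g) = 0, and div_L(v) = 1. Then v + g ∈ 2L, i.e. (v+g)/2 is an element of L. -/
open Matrix

/-- The underlying module of the lattice `U ⊕ ⟨2⟩`. -/
abbrev UplusTwoM : Type := (Fin 2 → ℤ) × (Fin 1 → ℤ)

/-- The bilinear form of the lattice `U ⊕ ⟨2⟩`. -/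
def UplusTwoB : UplusTwoM →ₗ[ℤ] UplusTwoM →ₗ[ℤ] ℤ :=
  prodBilin (gramBilin UGram) (gramBilin (rankOneGram 2))


theorem uplusTwoB_apply (x y : UplusTwoM) :
    UplusTwoB x y = x.1 0 * y.1 1 + x.1 1 * y.1 0 + 2 * (x.2 0 * y.2 0) := by
  simp [UplusTwoB, prodBilin, gramBilin, UGram, rankOneGram, Matrix.toLinearMap₂'_apply,
    Fin.sum_univ_two]
  ring

/-- The coordinate form of the divisibility statement, obtained by reduction modulo `4`. -/
theorem even_add_of_orthogonal {a b c d e f : ℤ} (hv : a * b + c * c = 1)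
    (hg : d * e + f * f = -1) (hvg : a * e + b * d + 2 * (c * f) = 0) (hab : Odd a ∨ Odd b) :
    Even (a + d) ∧ Even (b + e) ∧ Even (c + f) := by
  simp only [Int.odd_iff, Int.even_iff] at hab ⊢
  obtain ⟨a, rfl | rfl⟩ := Int.even_or_odd' a <;>
  obtain ⟨b, rfl | rfl⟩ := Int.even_or_odd' b <;>
  obtain ⟨c, rfl | rfl⟩ := Int.even_or_odd' c <;>
  obtain ⟨d, rfl | rfl⟩ := Int.even_or_odd' d <;>
  obtain ⟨e, rfl | rfl⟩ := Int.even_or_odd' e <;>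
  obtain ⟨f, rfl | rfl⟩ := Int.even_or_odd' f <;>
  ring_nf at hv hg hvg <;>
  omega

/-- Let `L = U ⊕ ⟨2⟩` and `v, g ∈ L` with `B(v,v) = 2`, `B(g,g) = −2`, `B(v,g) = 0` and
`div_L(v) = 1` (the values `B(v,·)` generate the unit ideal, i.e. `1` is attained).
Then `v + g ∈ 2L`. -/
theorem sum_divisible_by_two
    (v g : UplusTwoM)
    (hvv : UplusTwoB v v = 2)
    (hgg : UplusTwoB g g = -2)
    (hvg : UplusTwoB v g = 0)
    (hdiv : (∀ x, (1 : ℤ) ∣ UplusTwoB v x) ∧ ∃ x, UplusTwoB v x = 1) :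
    ∃ w : UplusTwoM, v + g = (2 : ℤ) • w := by
  rw [uplusTwoB_apply] at hvv hgg hvg
  obtain ⟨x, hx⟩ := hdiv.2
  rw [uplusTwoB_apply] at hx
  have hodd : Odd (v.1 0) ∨ Odd (v.1 1) := by
    by_contra! h
    obtain ⟨⟨k, hk⟩, ⟨l, hl⟩⟩ := h.imp Int.not_odd_iff_even.mp Int.not_odd_iff_even.mp
    rw [hk, hl] at hx
    ring_nf at hx
    omega
  obtain ⟨⟨p, hp⟩, ⟨q, hq⟩, ⟨r, hr⟩⟩ :=
    even_add_of_orthogonal (a := v.1 0) (b := v.1 1) (c := v.2 0)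
      (d := g.1 0) (e := g.1 1) (f := g.2 0)
      (by linarith) (by linarith) (by linarith) hodd
  refine ⟨(![p, q], ![r]), Prod.ext (funext fun i => ?_) (funext fun i => ?_)⟩ <;>
    fin_cases i <;> simp [hp, hq, hr, two_mul]
end
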